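/- Let a ∈ ℕ and let f : ({−a,…,a}² → Bool) → Bool be a local rule that is monotone (if x ≤ y pointwise then f(x) ≤ f(y)) and self-dual (f of the pointwise negation of x equals the negation of f(x)), and let A be the associated cellular automaton, (A s)(r) = f(δ ↦ s(r+δ)). Suppose there exist speeds v_x^+, v_x^−, v_y^+, v_y^− ∈ {−1,0,1}, not all zero, such that for each σ ∈ {+1,−1}: every γ_x^σ half-plane configuration H satisfies A(H) = T_{(v_x^σ,0)}(H), and every γ_y^σ half-plane configuration H satisfies A(H) = T_{(0,v_y^σ)}(H). Then A is an eroder: for every configuration s with finite damage there exists t ∈ ℕ such that A^t(s) is the all-false configuration. -/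

import Mathlib

/-- A spin configuration on the 2D lattice. -/
abbrev Config := ℤ × ℤ → Bool

/-- The all-false configuration. -/
def allFalse : Config := fun _ => false

/-- The translate of a configuration by `d`. -/
def translateBy (d : ℤ × ℤ) (s : Config) : Config := fun r => s (r - d)

/-- A `γ_x^σ` half-plane configuration: a half plane bounded by a line of
slope `σ/2`, in either orientation. -/
def IsGammaX (σ : ℤ) (H : Config) : Prop :=
  ∃ c : ℤ, (∀ r : ℤ × ℤ, H r = decide (c ≤ 2 * r.2 - σ * r.1)) ∨
           (∀ r : ℤ × ℤ, H r = !decide (c ≤ 2 * r.2 - σ * r.1))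

/-- A `γ_y^σ` half-plane configuration: a half plane bounded by a line of
slope `2σ`, in either orientation. -/
def IsGammaY (σ : ℤ) (H : Config) : Prop :=
  ∃ c : ℤ, (∀ r : ℤ × ℤ, H r = decide (c ≤ 2 * r.1 - σ * r.2)) ∨
           (∀ r : ℤ × ℤ, H r = !decide (c ≤ 2 * r.1 - σ * r.2))

/-- The square neighborhood of radius `a` around the origin. -/
abbrev Nbhd (a : ℕ) := {δ : ℤ × ℤ // |δ.1| ≤ (a : ℤ) ∧ |δ.2| ≤ (a : ℤ)}

/-- `A` is an eroder: every configuration with finite damage is mapped to the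
all-false configuration after finitely many steps. -/
def IsEroder (A : Config → Config) : Prop :=
  ∀ s : Config, {r : ℤ × ℤ | s r = true}.Finite → ∃ t : ℕ, A^[t] s = allFalse

/-- If a monotone map moves the half planes of both orientations bounded by level lines of `L`
at speed `w`, then damage confined to a strip between two such lines stays confined to the
moving strip. -/
theorem iterate_confined_to_strip {A : Config → Config}
    (hA : ∀ s u : Config, (∀ r, s r = true → u r = true) → ∀ r, A s r = true → A u r = true)
    {L : ℤ × ℤ → ℤ} {w : ℤ}
    (hge : ∀ c r, A (fun r => decide (c ≤ L r)) r = true → c ≤ L r + w)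
    (hlt : ∀ c r, A (fun r => !decide (c ≤ L r)) r = true → L r + w < c)
    {s : Config} {c d : ℤ} (hs : ∀ r, s r = true → c ≤ L r ∧ L r < d) (t : ℕ) :
    ∀ r, A^[t] s r = true → c ≤ L r + w * t ∧ L r + w * t < d := by
  induction t with
  | zero => simpa using hs
  | succ t ih =>
    intro r hr
    rw [Function.iterate_succ_apply'] at hr
    have h₁ := hge (c - w * t) r (hA _ _ (fun q hq => by
      have := ih q hq
      simp only [decide_eq_true_eq]
      linarith) r hr)
    have h₂ := hlt (d - w * t) r (hA _ _ (fun q hq => by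
      have := ih q hq
      simp only [Bool.not_eq_true', decide_eq_false_iff_not, not_le]
      linarith) r hr)
    push_cast
    constructor <;> linarith

/-- A finite set of lattice points is contained in a square centred at the origin. -/
theorem exists_nat_abs_le_of_finite {S : Set (ℤ × ℤ)} (hS : S.Finite) :
    ∃ M : ℕ, ∀ r ∈ S, |r.1| ≤ (M : ℤ) ∧ |r.2| ≤ (M : ℤ) := by
  obtain ⟨M, hM⟩ := (hS.image fun r => r.1.natAbs + r.2.natAbs).bddAbove
  refine ⟨M, fun r hr => ?_⟩
  have : r.1.natAbs + r.2.natAbs ≤ M := hM ⟨r, hr, rfl⟩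
  simp only [Int.abs_eq_natAbs]
  omega

theorem moving_walls_imply_erosion
    (a : ℕ) (f : (Nbhd a → Bool) → Bool)
    (hmono : ∀ x y : Nbhd a → Bool, (∀ i, x i ≤ y i) → f x ≤ f y)
    (hdual : ∀ x : Nbhd a → Bool, f (fun i => !(x i)) = !(f x))
    (A : Config → Config)
    (hA : ∀ (s : Config) (r : ℤ × ℤ), A s r = f (fun δ => s (r + δ.val)))
    (vxp vxm vyp vym : ℤ)
    (hvxp : vxp = -1 ∨ vxp = 0 ∨ vxp = 1) (hvxm : vxm = -1 ∨ vxm = 0 ∨ vxm = 1)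
    (hvyp : vyp = -1 ∨ vyp = 0 ∨ vyp = 1) (hvym : vym = -1 ∨ vym = 0 ∨ vym = 1)
    (hnz : ¬ (vxp = 0 ∧ vxm = 0 ∧ vyp = 0 ∧ vym = 0))
    (hxp : ∀ H : Config, IsGammaX 1 H → A H = translateBy (vxp, 0) H)
    (hxm : ∀ H : Config, IsGammaX (-1) H → A H = translateBy (vxm, 0) H)
    (hyp : ∀ H : Config, IsGammaY 1 H → A H = translateBy (0, vyp) H)
    (hym : ∀ H : Config, IsGammaY (-1) H → A H = translateBy (0, vym) H) :
    IsEroder A := by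
  have mono : ∀ s u : Config, (∀ r, s r = true → u r = true) →
      ∀ r, A s r = true → A u r = true := by
    intro s u hsu r hr
    rw [hA] at hr ⊢
    exact hmono _ _ (fun i => hsu _) hr
  intro s hs
  obtain ⟨M, hM⟩ := exists_nat_abs_le_of_finite hs
  have strip : ∀ (L : ℤ × ℤ → ℤ) (w : ℤ),
      (∀ c r, A (fun r => decide (c ≤ L r)) r = decide (c ≤ L r + w)) →
      (∀ c r, A (fun r => !decide (c ≤ L r)) r = !decide (c ≤ L r + w)) →
      (∀ r, |r.1| ≤ (M : ℤ) ∧ |r.2| ≤ (M : ℤ) → |L r| ≤ 3 * M) →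
      ∀ (t : ℕ) (r : ℤ × ℤ), A^[t] s r = true → |L r + w * t| ≤ 3 * M := by
    intro L w h₁ h₂ hL t r hr
    have := iterate_confined_to_strip mono (L := L) (w := w) (s := s)
      (c := -(3 * M)) (d := 3 * M + 1)
      (fun c r h => by simpa [h₁] using h) (fun c r h => by simpa [h₂] using h)
      (fun r h => by have := abs_le.1 (hL r (hM r h)); omega) t r hr
    exact abs_le.2 (by omega)
  have sxp := strip (fun r => 2 * r.2 - 1 * r.1) vxp
    (fun c r => by
      rw [hxp _ ⟨c, Or.inl fun _ => rfl⟩]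
      simp only [translateBy, Prod.fst_sub, Prod.snd_sub]; congr 2; ring)
    (fun c r => by
      rw [hxp _ ⟨c, Or.inr fun _ => rfl⟩]
      simp only [translateBy, Prod.fst_sub, Prod.snd_sub]; congr 3; ring)
    (fun r h => by simp only [abs_le] at h ⊢; omega) (18 * M + 1)
  have sxm := strip (fun r => 2 * r.2 - (-1) * r.1) (-vxm)
    (fun c r => by
      rw [hxm _ ⟨c, Or.inl fun _ => rfl⟩]
      simp only [translateBy, Prod.fst_sub, Prod.snd_sub]; congr 2; ring)
    (fun c r => by
      rw [hxm _ ⟨c, Or.inr fun _ => rfl⟩]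
      simp only [translateBy, Prod.fst_sub, Prod.snd_sub]; congr 3; ring)
    (fun r h => by simp only [abs_le] at h ⊢; omega) (18 * M + 1)
  have syp := strip (fun r => 2 * r.1 - 1 * r.2) vyp
    (fun c r => by
      rw [hyp _ ⟨c, Or.inl fun _ => rfl⟩]
      simp only [translateBy, Prod.fst_sub, Prod.snd_sub]; congr 2; ring)
    (fun c r => by
      rw [hyp _ ⟨c, Or.inr fun _ => rfl⟩]
      simp only [translateBy, Prod.fst_sub, Prod.snd_sub]; congr 3; ring)
    (fun r h => by simp only [abs_le] at h ⊢; omega) (18 * M + 1)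
  have sym := strip (fun r => 2 * r.1 - (-1) * r.2) (-vym)
    (fun c r => by
      rw [hym _ ⟨c, Or.inl fun _ => rfl⟩]
      simp only [translateBy, Prod.fst_sub, Prod.snd_sub]; congr 2; ring)
    (fun c r => by
      rw [hym _ ⟨c, Or.inr fun _ => rfl⟩]
      simp only [translateBy, Prod.fst_sub, Prod.snd_sub]; congr 3; ring)
    (fun r h => by simp only [abs_le] at h ⊢; omega) (18 * M + 1)
  refine ⟨18 * M + 1, funext fun r => ?_⟩
  by_contra hr
  replace hr : A^[18 * M + 1] s r = true := by simpa [allFalse] using hr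
  have bxp := abs_le.1 (sxp r hr)
  have bxm := abs_le.1 (sxm r hr)
  have byp := abs_le.1 (syp r hr)
  have bym := abs_le.1 (sym r hr)
  -- Strips moving at these speeds have a common velocity only if both integers below vanish.
  have small : ∀ k : ℤ, |k * (18 * M + 1 : ℕ)| ≤ 18 * M → k = 0 := by
    intro k hk
    by_contra hk0
    have h1 : 1 ≤ |k| := Int.one_le_abs hk0
    rw [abs_mul, Nat.abs_cast] at hk
    push_cast at hk
    nlinarith
  have e₁ := small (2 * (vxm + vxp) + vyp - vym) (abs_le.2 (by constructor <;> linarith))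
  have e₂ := small (vxm - vxp - 2 * (vym + vyp)) (abs_le.2 (by constructor <;> linarith))
  omega
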